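/- arXiv:2103.07400 — 3 statements merged into one kernel-verified Lean document; each statement's English description precedes it below -/
import Mathlib

section
/- Let n,m ≥ 1, 0 < q < 1, 0 < t < 1, and let ξ,ξ′ > 0 be admissible. Then for all P,Q ∈ Λ_{n,m;q,t}, ⟨P,Q⟩′_{n,m;q,t}(ξ,ξ′) = conj(⟨Q,P⟩′_{n,m;q,t}(1/ξ,1/ξ′)). -/
open Complex MeasureTheory Finset

noncomputable section

/-- The infinite q-Pochhammer symbol `(a;q)_∞`. -/
def qPochInf (a q : ℂ) : ℂ := ∏' k : ℕ, (1 - a * q ^ k)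

/-- The weight function `Δ_N(z;q,t)`. -/
def DeltaW {N : ℕ} (q t : ℂ) (z : Fin N → ℂ) : ℂ :=
  ∏ i : Fin N, ∏ j : Fin N,
    if i ≠ j then qPochInf (z i / z j) q / qPochInf (t * (z i / z j)) q else 1

/-- The weight function `Δ_{n,m}(x,y;q,t)` for real parameters `0 < q,t < 1`. -/
def DeltaNM (n m : ℕ) (q t : ℝ) (x : Fin n → ℂ) (y : Fin m → ℂ) : ℂ :=
  DeltaW (q : ℂ) (t : ℂ) x * DeltaW (t : ℂ) (q : ℂ) y /
    ∏ i : Fin n, ∏ j : Fin m,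
      ((1 - (Real.sqrt q : ℂ)⁻¹ * (Real.sqrt t : ℂ) * (x i / y j)) *
        (1 - (Real.sqrt q : ℂ)⁻¹ * (Real.sqrt t : ℂ) * (y j / x i)))

/-- Membership in the algebra `Λ_{n,m;q,t}`: `P` is (the evaluation of) a polynomial in
`x_1,…,x_n,y_1,…,y_m`, symmetric in each set of variables separately, and satisfying the
symmetry condition `T_{q,x_i} P = T_{t⁻¹,y_j} P` at `q^{1/2} x_i = t^{-1/2} y_j`. -/
def InLambda (n m : ℕ) (q t : ℝ) (P : (Fin n → ℂ) → (Fin m → ℂ) → ℂ) : Prop :=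
  (∃ p : MvPolynomial (Fin n ⊕ Fin m) ℂ,
      ∀ (x : Fin n → ℂ) (y : Fin m → ℂ), P x y = MvPolynomial.eval (Sum.elim x y) p) ∧
    (∀ (σ : Equiv.Perm (Fin n)) (τ : Equiv.Perm (Fin m)) (x : Fin n → ℂ) (y : Fin m → ℂ),
      P (x ∘ σ) (y ∘ τ) = P x y) ∧
    ∀ (i : Fin n) (j : Fin m) (x : Fin n → ℂ) (y : Fin m → ℂ),
      (Real.sqrt q : ℂ) * x i = (Real.sqrt t : ℂ)⁻¹ * y j →
        P (Function.update x i ((q : ℂ) * x i)) y = P x (Function.update y j ((t : ℂ)⁻¹ * y j))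

/-- The conjugate `Q*(x,y) = conj (Q(1/conj x, 1/conj y))`. -/
def starFun {n m : ℕ} (Q : (Fin n → ℂ) → (Fin m → ℂ) → ℂ) :
    (Fin n → ℂ) → (Fin m → ℂ) → ℂ := fun x y =>
  starRingEnd ℂ (Q (fun i => (starRingEnd ℂ (x i))⁻¹) (fun j => (starRingEnd ℂ (y j))⁻¹))

/-- The sesquilinear pairing `⟨P,Q⟩′_{n,m;q,t}(ξ,ξ′)`, as an iterated torus integral. -/
def pairingNM (n m : ℕ) (q t : ℝ) (P Q : (Fin n → ℂ) → (Fin m → ℂ) → ℂ) (ξ ξ' : ℝ) : ℂ :=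
  (1 / ((n.factorial : ℂ) * (m.factorial : ℂ))) * (1 / (2 * (Real.pi : ℂ)) ^ (n + m)) *
    ∫ θ in Set.univ.pi fun _ : Fin n => Set.Ioc (0 : ℝ) (2 * Real.pi),
      ∫ φ in Set.univ.pi fun _ : Fin m => Set.Ioc (0 : ℝ) (2 * Real.pi),
        DeltaNM n m q t (fun i => (ξ : ℂ) * Complex.exp (Complex.I * (θ i : ℂ)))
            (fun j => (ξ' : ℂ) * Complex.exp (Complex.I * (φ j : ℂ))) *
          P (fun i => (ξ : ℂ) * Complex.exp (Complex.I * (θ i : ℂ)))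
            (fun j => (ξ' : ℂ) * Complex.exp (Complex.I * (φ j : ℂ))) *
          starFun Q (fun i => (ξ : ℂ) * Complex.exp (Complex.I * (θ i : ℂ)))
            (fun j => (ξ' : ℂ) * Complex.exp (Complex.I * (φ j : ℂ)))

/-- `M(q,t) = max(q^{1/2} t^{-1/2}, q^{-1/2} t^{1/2})`. -/
def Mmax (q t : ℝ) : ℝ := max (Real.sqrt q / Real.sqrt t) (Real.sqrt t / Real.sqrt q)

/-- Radii `ξ, ξ′ > 0` are admissible if `ξ/ξ′ > M(q,t)` or `ξ/ξ′ < 1/M(q,t)`. -/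
def Admissible (q t ξ ξ' : ℝ) : Prop := ξ / ξ' > Mmax q t ∨ ξ / ξ' < (Mmax q t)⁻¹


lemma conj_qPochInf_ofReal (a : ℂ) (q : ℝ) :
    starRingEnd ℂ (qPochInf a q) = qPochInf (starRingEnd ℂ a) q := by
  unfold qPochInf
  rw [Function.LeftInverse.map_tprod _ Complex.continuous_conj Complex.continuous_conj
    Complex.conj_conj]
  simp

lemma conj_DeltaW_ofReal {N : ℕ} (q t : ℝ) (z : Fin N → ℂ) :
    starRingEnd ℂ (DeltaW (q : ℂ) (t : ℂ) z) =
      DeltaW (q : ℂ) (t : ℂ) (fun i => starRingEnd ℂ (z i)) := by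
  simp only [DeltaW, map_prod, apply_ite (starRingEnd ℂ), map_div₀, conj_qPochInf_ofReal, map_mul,
    conj_ofReal, map_one]

lemma DeltaW_inv {N : ℕ} (q t : ℂ) (z : Fin N → ℂ) :
    DeltaW q t (fun i => (z i)⁻¹) = DeltaW q t z := by
  unfold DeltaW
  rw [Finset.prod_comm]
  simp only [inv_div_inv, ne_comm]

lemma conj_DeltaNM (n m : ℕ) (q t : ℝ) (x : Fin n → ℂ) (y : Fin m → ℂ) :
    starRingEnd ℂ (DeltaNM n m q t x y) =
      DeltaNM n m q t (fun i => starRingEnd ℂ (x i)) (fun j => starRingEnd ℂ (y j)) := by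
  simp only [DeltaNM, map_div₀, map_mul, map_prod, conj_DeltaW_ofReal, map_sub, map_one, map_inv₀,
    conj_ofReal]

lemma DeltaNM_inv (n m : ℕ) (q t : ℝ) (x : Fin n → ℂ) (y : Fin m → ℂ) :
    DeltaNM n m q t (fun i => (x i)⁻¹) (fun j => (y j)⁻¹) = DeltaNM n m q t x y := by
  simp only [DeltaNM, DeltaW_inv, inv_div_inv]
  congr 1
  exact Finset.prod_congr rfl fun i _ => Finset.prod_congr rfl fun j _ => mul_comm _ _

lemma inv_conj_ofReal_mul_exp (r θ : ℝ) :
    (starRingEnd ℂ ((r : ℂ) * Complex.exp (Complex.I * θ)))⁻¹ =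
      ((r⁻¹ : ℝ) : ℂ) * Complex.exp (Complex.I * θ) := by
  simp [← Complex.exp_conj, Complex.exp_neg, mul_comm]

lemma conj_DeltaNM_torus (n m : ℕ) (q t r s : ℝ) (θ : Fin n → ℝ) (φ : Fin m → ℝ) :
    starRingEnd ℂ (DeltaNM n m q t
        (fun i => ((r⁻¹ : ℝ) : ℂ) * Complex.exp (Complex.I * (θ i : ℂ)))
        (fun j => ((s⁻¹ : ℝ) : ℂ) * Complex.exp (Complex.I * (φ j : ℂ)))) =
      DeltaNM n m q t (fun i => (r : ℂ) * Complex.exp (Complex.I * (θ i : ℂ)))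
        (fun j => (s : ℂ) * Complex.exp (Complex.I * (φ j : ℂ))) := by
  rw [conj_DeltaNM, ← DeltaNM_inv]
  simp only [inv_conj_ofReal_mul_exp, inv_inv]

theorem statement1 (n m : ℕ) (hn : 1 ≤ n) (hm : 1 ≤ m) (q t : ℝ)
    (hq0 : 0 < q) (hq1 : q < 1) (ht0 : 0 < t) (ht1 : t < 1)
    (ξ ξ' : ℝ) (hξ : 0 < ξ) (hξ' : 0 < ξ') (hadm : Admissible q t ξ ξ')
    (P Q : (Fin n → ℂ) → (Fin m → ℂ) → ℂ)
    (hP : InLambda n m q t P) (hQ : InLambda n m q t Q) :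
    pairingNM n m q t P Q ξ ξ' = starRingEnd ℂ (pairingNM n m q t Q P ξ⁻¹ ξ'⁻¹) := by
  unfold pairingNM
  simp only [starFun, inv_conj_ofReal_mul_exp, inv_inv]
  simp only [map_mul, ← integral_conj, conj_DeltaNM_torus, Complex.conj_conj]
  congr 1
  · simp [Complex.conj_ofNat]
  · simp only [mul_right_comm]
end
end

section
/- Let n,m ≥ 1, 0 < q < 1, 0 < t < 1, and P,Q ∈ Λ_{n,m;q,t}. If ξ₁,ξ₁′,ξ₂,ξ₂′ > 0 satisfy ξ₁/ξ₁′ > M(q,t) and ξ₂/ξ₂′ > M(q,t), then ⟨P,Q⟩′_{n,m;q,t}(ξ₁,ξ₁′) = ⟨P,Q⟩′_{n,m;q,t}(ξ₂,ξ₂′). Likewise, if ξ₁/ξ₁′ < 1/M(q,t) and ξ₂/ξ₂′ < 1/M(q,t), then ⟨P,Q⟩′_{n,m;q,t}(ξ₁,ξ₁′) = ⟨P,Q⟩′_{n,m;q,t}(ξ₂,ξ₂′). -/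
open Complex MeasureTheory Finset

noncomputable section

instance fact_two_pi_pos : Fact (0 < 2 * Real.pi) := ⟨Real.two_pi_pos⟩

/-- The circle group `ℝ / 2πℤ`. -/
abbrev Circ : Type := AddCircle (2 * Real.pi)

/-- The point `e^{iα}` of the unit circle attached to an angle `α`. -/
def unitExp (α : Circ) : ℂ := (AddCircle.toCircle α : ℂ)

lemma norm_unitExp (α : Circ) : ‖unitExp α‖ = 1 := Circle.norm_coe _

lemma unitExp_ne_zero (α : Circ) : unitExp α ≠ 0 := Circle.coe_ne_zero _

lemma unitExp_add (α β : Circ) : unitExp (α + β) = unitExp α * unitExp β := by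
  simp [unitExp, AddCircle.toCircle_add]

@[fun_prop]
lemma continuous_unitExp : Continuous unitExp :=
  continuous_subtype_val.comp AddCircle.continuous_toCircle

lemma unitExp_coe (θ : ℝ) : unitExp (θ : Circ) = exp (I * θ) := by
  have h : 2 * Real.pi / (2 * Real.pi) = 1 := div_self Real.two_pi_pos.ne'
  rw [unitExp, AddCircle.toCircle_apply_mk, h, one_mul, Circle.coe_exp, mul_comm]

/-- Circle averages of a function holomorphic on an annulus do not depend on the radius. -/
lemma integral_circle_eq_of_differentiableAt {f : ℂ → ℂ} {r R : ℝ} (hr : 0 < r) (hrR : r ≤ R)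
    (hf : ∀ s : ℂ, r ≤ ‖s‖ → ‖s‖ ≤ R → DifferentiableAt ℂ f s) :
    ∫ α : Circ, f (R * unitExp α) = ∫ α : Circ, f (r * unitExp α) := by
  have key : ∀ ρ : ℝ, 0 < ρ →
      ∫ α : Circ, f (ρ * unitExp α) = I⁻¹ * ∮ z in C(0, ρ), (z - 0)⁻¹ • f z := by
    intro ρ hρ
    have hρ' : (ρ : ℂ) ≠ 0 := by exact_mod_cast hρ.ne'
    rw [← AddCircle.intervalIntegral_preimage _ 0, zero_add, circleIntegral,
      ← intervalIntegral.integral_const_mul]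
    refine intervalIntegral.integral_congr fun θ _ => ?_
    have hz : circleMap 0 ρ θ = ρ * exp (I * θ) := by simp [circleMap, mul_comm]
    have hz0 : circleMap 0 ρ θ ≠ 0 := by rw [hz]; exact mul_ne_zero hρ' (exp_ne_zero _)
    simp only [unitExp_coe, deriv_circleMap, smul_eq_mul, sub_zero, ← hz]
    field_simp [I_ne_zero]
  rw [key R (hr.trans_le hrR), key r hr,
    circleIntegral_sub_center_inv_smul_eq_of_differentiable_on_annulus_off_countable hr hrR
      Set.countable_empty]
  · rintro s ⟨h1, h2⟩
    simp only [Metric.mem_closedBall, Metric.mem_ball, dist_zero_right, not_lt] at h1 h2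
    exact (hf s h2 h1).continuousAt.continuousWithinAt
  · rintro s ⟨⟨h1, h2⟩, -⟩
    simp only [Metric.mem_closedBall, Metric.mem_ball, dist_zero_right, not_le] at h1 h2
    exact hf s h2.le h1.le

/-- If `K s` is holomorphic in `s` on an annulus and its integral is invariant under rotations of
`s`, then this integral takes the same value at the two radii of the annulus. -/
lemma integral_eq_of_rotation_invariant {X : Type*} [TopologicalSpace X] [CompactSpace X]
    [MeasurableSpace X] [OpensMeasurableSpace X]
    (μ : Measure X) [IsFiniteMeasure μ] [SecondCountableTopology X] {K : ℂ → X → ℂ} {r R : ℝ}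
    (hr : 0 < r) (hrR : r ≤ R)
    (hdiff : ∀ x, ∀ s : ℂ, r ≤ ‖s‖ → ‖s‖ ≤ R → DifferentiableAt ℂ (fun s => K s x) s)
    (hcont : ∀ ρ : ℝ, r ≤ ρ → ρ ≤ R → Continuous fun p : Circ × X => K (ρ * unitExp p.1) p.2)
    (hrot : ∀ ρ : ℝ, r ≤ ρ → ρ ≤ R → ∀ α : Circ,
      ∫ x, K (ρ * unitExp α) x ∂μ = ∫ x, K ρ x ∂μ) :
    ∫ x, K R x ∂μ = ∫ x, K r x ∂μ := by
  have key : ∀ ρ : ℝ, r ≤ ρ → ρ ≤ R →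
      volume.real (Set.univ : Set Circ) • ∫ x, K ρ x ∂μ =
        ∫ x, (∫ α : Circ, K (ρ * unitExp α) x) ∂μ := by
    intro ρ h1 h2
    rw [← integral_integral_swap, ← integral_const]
    · exact integral_congr_ae (.of_forall fun α => (hrot ρ h1 h2 α).symm)
    · exact (hcont ρ h1 h2).integrable_of_hasCompactSupport (.of_compactSpace _)
  have hvol : volume.real (Set.univ : Set Circ) ≠ 0 := by
    simp [measureReal_def, AddCircle.measure_univ, Real.pi_pos.le, Real.pi_ne_zero]
  refine smul_right_injective ℂ hvol ?_
  simp only [key R hrR le_rfl, key r le_rfl hrR]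
  exact integral_congr_ae (.of_forall fun x =>
    integral_circle_eq_of_differentiableAt hr hrR (hdiff x))

/-- Integrals over the box `(0, 2π]^N` of functions of the angles modulo `2π`. -/
lemma setIntegral_box_eq {N : ℕ} {f : (Fin N → Circ) → ℂ} (hf : Continuous f) :
    ∫ θ in Set.univ.pi fun _ : Fin N => Set.Ioc (0 : ℝ) (2 * Real.pi), f (fun i => (θ i : Circ)) =
      ∫ u, f u := by
  have h : MeasurePreserving (fun (θ : Fin N → ℝ) i => (θ i : Circ))
      (volume.restrict (Set.univ.pi fun _ : Fin N => Set.Ioc (0 : ℝ) (2 * Real.pi))) volume := by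
    rw [volume_pi, Measure.restrict_pi_pi, volume_pi]
    refine measurePreserving_pi _ _ fun i => ?_
    simpa using AddCircle.measurePreserving_mk (2 * Real.pi) 0
  rw [← h.map_eq, integral_map h.measurable.aemeasurable hf.aestronglyMeasurable]

lemma summable_mul_pow {a q : ℂ} (hq : ‖q‖ < 1) : Summable fun k : ℕ => ‖a‖ * ‖q‖ ^ k :=
  (summable_geometric_of_lt_one (norm_nonneg _) hq).mul_left _

lemma continuous_qPochInf {q : ℂ} (hq : ‖q‖ < 1) : Continuous fun a => qPochInf a q := by
  rw [continuous_iff_continuousAt]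
  intro a
  have hs : Summable fun k : ℕ => (‖a‖ + 1) * ‖q‖ ^ k :=
    (summable_geometric_of_lt_one (norm_nonneg _) hq).mul_left _
  have h := Summable.hasProdUniformlyOn_nat_one_add (f := fun k (b : ℂ) => -(b * q ^ k))
    (isCompact_closedBall a 1) hs (.of_forall fun k b hb => ?_) fun k => by fun_prop
  · have hc : ContinuousOn (fun b => ∏' k : ℕ, (1 + -(b * q ^ k))) (Metric.closedBall a 1) :=
      h.tendstoUniformlyOn_finsetRange.continuousOn (.of_forall fun N => by fun_prop)
    simp only [← sub_eq_add_neg] at hc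
    exact hc.continuousAt (Metric.closedBall_mem_nhds a one_pos)
  · rw [norm_neg, norm_mul, norm_pow]
    gcongr
    have := norm_le_norm_add_norm_sub a b
    rw [Metric.mem_closedBall, dist_eq_norm] at hb
    linarith [norm_sub_rev a b]

lemma qPochInf_ne_zero {a q : ℂ} (ha : ‖a‖ < 1) (hq : ‖q‖ < 1) : qPochInf a q ≠ 0 := by
  have h : ∀ k : ℕ, ‖a * q ^ k‖ = ‖a‖ * ‖q‖ ^ k := fun k => by rw [norm_mul, norm_pow]
  simp only [qPochInf, sub_eq_add_neg]
  refine tprod_one_add_ne_zero_of_summable (fun k hk => ?_) ?_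
  · have h1 : a * q ^ k = 1 := (sub_eq_zero.1 (by rwa [sub_eq_add_neg])).symm
    have h2 : ‖a‖ * ‖q‖ ^ k < 1 := mul_lt_one_of_nonneg_of_lt_one_left (norm_nonneg _) ha
      (pow_le_one₀ (norm_nonneg _) hq.le)
    rw [← h, h1, norm_one] at h2
    exact lt_irrefl _ h2
  · simpa only [norm_neg, h] using summable_mul_pow hq

lemma continuous_DeltaW {Z : Type*} [TopologicalSpace Z] {N : ℕ} {q t : ℂ} (hq : ‖q‖ < 1)
    (ht : ‖t‖ < 1) {z : Z → Fin N → ℂ} (hz : ∀ i, Continuous fun p => z p i) {r : ℝ} (hr : 0 < r)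
    (hn : ∀ p i, ‖z p i‖ = r) : Continuous fun p => DeltaW q t (z p) := by
  unfold DeltaW
  refine continuous_finsetProd _ fun i _ => continuous_finsetProd _ fun j _ => ?_
  split_ifs
  · have hdiv : Continuous fun p => z p i / z p j :=
      (hz i).div (hz j) fun p => by rw [← norm_pos_iff, hn]; exact hr
    refine ((continuous_qPochInf hq).comp hdiv).div
      ((continuous_qPochInf hq).comp (continuous_const.mul hdiv)) fun p => qPochInf_ne_zero ?_ hq
    rwa [norm_mul, norm_div, hn, hn, div_self hr.ne', mul_one]
  · exact continuous_const

lemma DeltaW_smul {N : ℕ} (q t : ℂ) {s : ℂ} (hs : s ≠ 0) (z : Fin N → ℂ) :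
    DeltaW q t (fun i => s * z i) = DeltaW q t z := by
  simp only [DeltaW, mul_div_mul_left _ _ hs]

lemma starFun_eq_eval {n m : ℕ} {Q : (Fin n → ℂ) → (Fin m → ℂ) → ℂ}
    {p : MvPolynomial (Fin n ⊕ Fin m) ℂ}
    (hp : ∀ x y, Q x y = MvPolynomial.eval (Sum.elim x y) p) (x : Fin n → ℂ) (y : Fin m → ℂ) :
    starFun Q x y = MvPolynomial.eval (Sum.elim (fun i => (x i)⁻¹) fun j => (y j)⁻¹)
      (MvPolynomial.map (starRingEnd ℂ) p) := by
  rw [starFun, hp, MvPolynomial.eval_map, MvPolynomial.eval, MvPolynomial.coe_eval₂Hom,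
    MvPolynomial.eval₂_comp_left, RingHom.comp_id]
  congr 1
  ext (i | j) <;> simp

lemma differentiableAt_eval {σ : Type*} (p : MvPolynomial σ ℂ) {f : ℂ → σ → ℂ} {s : ℂ}
    (hf : ∀ i, DifferentiableAt ℂ (fun s => f s i) s) :
    DifferentiableAt ℂ (fun s => MvPolynomial.eval (f s) p) s := by
  induction p using MvPolynomial.induction_on with
  | C a => simp
  | add p q hp hq => simpa only [map_add] using hp.fun_add hq
  | mul_X p i hp => simpa only [map_mul, MvPolynomial.eval_X] using hp.fun_mul (hf i)

/-- The integrand of the pairing. -/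
def integrandNM (n m : ℕ) (q t : ℝ) (P Q : (Fin n → ℂ) → (Fin m → ℂ) → ℂ)
    (x : Fin n → ℂ) (y : Fin m → ℂ) : ℂ :=
  DeltaNM n m q t x y * P x y * starFun Q x y

/-- Radii for which the denominator of the weight function does not vanish on the torus. -/
def NonResonant (c a b : ℝ) : Prop := c * a ≠ b ∧ c * b ≠ a

lemma one_sub_ne_zero_of_norm {c : ℝ} (hc : 0 < c) {x y : ℂ} (hy : y ≠ 0)
    (h : c * ‖x‖ ≠ ‖y‖) : 1 - (c : ℂ) * (x / y) ≠ 0 := by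
  intro h0
  have h1 : (c : ℂ) * (x / y) = 1 := (sub_eq_zero.1 h0).symm
  have h2 : (c : ℂ) * x = y := by field_simp at h1; exact h1
  apply h
  rw [← h2, norm_mul, norm_real, Real.norm_of_nonneg hc.le]

section Integrand

variable {n m : ℕ} {q t : ℝ} {P Q : (Fin n → ℂ) → (Fin m → ℂ) → ℂ}

/-- The ratio `t^{1/2} / q^{1/2}`. -/
def sqrtRatio (q t : ℝ) : ℝ := (Real.sqrt q)⁻¹ * Real.sqrt t

lemma sqrtRatio_pos (hq0 : 0 < q) (ht0 : 0 < t) : 0 < sqrtRatio q t := by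
  unfold sqrtRatio; positivity

/-- The product in the denominator of the weight function. -/
def denomNM (c : ℂ) (x : Fin n → ℂ) (y : Fin m → ℂ) : ℂ :=
  ∏ i : Fin n, ∏ j : Fin m, ((1 - c * (x i / y j)) * (1 - c * (y j / x i)))

lemma DeltaNM_eq (x : Fin n → ℂ) (y : Fin m → ℂ) :
    DeltaNM n m q t x y = DeltaW (q : ℂ) (t : ℂ) x * DeltaW (t : ℂ) (q : ℂ) y /
      denomNM (sqrtRatio q t : ℂ) x y := by
  simp [DeltaNM, denomNM, sqrtRatio]

lemma denomNM_ne_zero {c : ℝ} (hc : 0 < c) {x : Fin n → ℂ} {y : Fin m → ℂ}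
    (hx : ∀ i, x i ≠ 0) (hy : ∀ j, y j ≠ 0) (h : ∀ i j, NonResonant c ‖x i‖ ‖y j‖) :
    denomNM (c : ℂ) x y ≠ 0 :=
  Finset.prod_ne_zero_iff.2 fun i _ => Finset.prod_ne_zero_iff.2 fun j _ =>
    mul_ne_zero (one_sub_ne_zero_of_norm hc (hy j) (h i j).1)
      (one_sub_ne_zero_of_norm hc (hx i) (h i j).2)

lemma continuous_integrandNM (hq0 : 0 < q) (hq1 : q < 1) (ht0 : 0 < t) (ht1 : t < 1)
    (hP : InLambda n m q t P) (hQ : InLambda n m q t Q) {Z : Type*} [TopologicalSpace Z]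
    {x : Z → Fin n → ℂ} {y : Z → Fin m → ℂ} (hx : ∀ i, Continuous fun z => x z i)
    (hy : ∀ j, Continuous fun z => y z j) {a b : ℝ} (ha : 0 < a) (hb : 0 < b)
    (hxa : ∀ z i, ‖x z i‖ = a) (hyb : ∀ z j, ‖y z j‖ = b)
    (hab : NonResonant (sqrtRatio q t) a b) :
    Continuous fun z => integrandNM n m q t P Q (x z) (y z) := by
  obtain ⟨p, hp⟩ := hP.1
  obtain ⟨p', hp'⟩ := hQ.1
  have hx0 : ∀ z i, x z i ≠ 0 := fun z i => by rw [← norm_pos_iff, hxa]; exact ha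
  have hy0 : ∀ z j, y z j ≠ 0 := fun z j => by rw [← norm_pos_iff, hyb]; exact hb
  have hq : ‖(q : ℂ)‖ < 1 := by rwa [norm_real, Real.norm_of_nonneg hq0.le]
  have ht : ‖(t : ℂ)‖ < 1 := by rwa [norm_real, Real.norm_of_nonneg ht0.le]
  simp only [integrandNM, DeltaNM_eq, hp, starFun_eq_eval hp']
  refine ((((continuous_DeltaW hq ht hx ha hxa).mul (continuous_DeltaW ht hq hy hb hyb)).div
    ?_ fun z => denomNM_ne_zero (sqrtRatio_pos hq0 ht0) (hx0 z) (hy0 z) fun i j => ?_).mul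
    ((MvPolynomial.continuous_eval p).comp ?_)).mul ((MvPolynomial.continuous_eval _).comp ?_)
  · exact continuous_finsetProd _ fun i _ => continuous_finsetProd _ fun j _ =>
      (continuous_const.sub (continuous_const.mul ((hx i).div (hy j) fun z => hy0 z j))).mul
        (continuous_const.sub (continuous_const.mul ((hy j).div (hx i) fun z => hx0 z i)))
  · rwa [hxa, hyb]
  · exact continuous_pi (Sum.rec hx hy)
  · exact continuous_pi (Sum.rec (fun i => (hx i).inv₀ fun z => hx0 z i)
      fun j => (hy j).inv₀ fun z => hy0 z j)

lemma differentiableAt_integrandNM (hq0 : 0 < q) (ht0 : 0 < t)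
    (hP : InLambda n m q t P) (hQ : InLambda n m q t Q)
    {x : ℂ → Fin n → ℂ} {y : ℂ → Fin m → ℂ} {s : ℂ}
    (hx : ∀ i, DifferentiableAt ℂ (fun s => x s i) s)
    (hy : ∀ j, DifferentiableAt ℂ (fun s => y s j) s)
    (hxW : DifferentiableAt ℂ (fun s => DeltaW (q : ℂ) (t : ℂ) (x s)) s)
    (hyW : DifferentiableAt ℂ (fun s => DeltaW (t : ℂ) (q : ℂ) (y s)) s)
    (hx0 : ∀ i, x s i ≠ 0) (hy0 : ∀ j, y s j ≠ 0)
    (hxy : ∀ i j, NonResonant (sqrtRatio q t) ‖x s i‖ ‖y s j‖) :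
    DifferentiableAt ℂ (fun s => integrandNM n m q t P Q (x s) (y s)) s := by
  obtain ⟨p, hp⟩ := hP.1
  obtain ⟨p', hp'⟩ := hQ.1
  simp only [integrandNM, DeltaNM_eq, hp, starFun_eq_eval hp']
  refine (((hxW.mul hyW).div ?_ (denomNM_ne_zero (sqrtRatio_pos hq0 ht0) hx0 hy0 hxy)).mul
    (differentiableAt_eval p (Sum.rec hx hy))).mul (differentiableAt_eval _ (Sum.rec
      (fun i => (hx i).inv (hx0 i)) fun j => (hy j).inv (hy0 j)))
  exact DifferentiableAt.fun_finsetProd fun i _ => DifferentiableAt.fun_finsetProd fun j _ =>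
    (((hx i).div (hy j) (hy0 j)).const_mul _ |>.const_sub _).mul
      (((hy j).div (hx i) (hx0 i)).const_mul _ |>.const_sub _)

/-- The integral of the integrand over the torus of complex radii `s`, `s'`. -/
def torusPairing (n m : ℕ) (q t : ℝ) (P Q : (Fin n → ℂ) → (Fin m → ℂ) → ℂ) (s s' : ℂ) : ℂ :=
  ∫ w : (Fin n → Circ) × (Fin m → Circ),
    integrandNM n m q t P Q (fun i => s * unitExp (w.1 i)) fun j => s' * unitExp (w.2 j)

lemma torusPairing_rotate (s s' : ℂ) (α β : Circ) :
    torusPairing n m q t P Q (s * unitExp α) (s' * unitExp β) = torusPairing n m q t P Q s s' := by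
  have : (volume : Measure ((Fin n → Circ) × (Fin m → Circ))).IsAddLeftInvariant :=
    Measure.prod.instIsAddLeftInvariant
  have h := integral_add_left_eq_self (μ := (volume : Measure ((Fin n → Circ) × (Fin m → Circ))))
    (fun w => integrandNM n m q t P Q (fun i => s * unitExp (w.1 i)) fun j => s' * unitExp (w.2 j))
    (fun _ => α, fun _ => β)
  rw [torusPairing, torusPairing, ← h]
  refine integral_congr_ae (.of_forall fun w => ?_)
  simp only [Prod.fst_add, Prod.snd_add, Pi.add_apply, unitExp_add, mul_assoc]

lemma torusPairing_eq_left (hq0 : 0 < q) (hq1 : q < 1) (ht0 : 0 < t) (ht1 : t < 1)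
    (hP : InLambda n m q t P) (hQ : InLambda n m q t Q) {r R b : ℝ} (hr : 0 < r) (hrR : r ≤ R)
    (hb : 0 < b) (h : ∀ ρ, r ≤ ρ → ρ ≤ R → NonResonant (sqrtRatio q t) ρ b) :
    torusPairing n m q t P Q R b = torusPairing n m q t P Q r b := by
  have h_const := integral_eq_of_rotation_invariant
    (volume : Measure ((Fin n → Circ) × (Fin m → Circ))) (K := fun s w => integrandNM n m q t P Q
      (fun i => s * unitExp (w.1 i)) fun j => b * unitExp (w.2 j)) hr hrR
  refine h_const ?_ ?_ ?_
  · intro w s hs1 hs2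
    have hs0 : s ≠ 0 := norm_pos_iff.1 (hr.trans_le hs1)
    have hb0 : (b : ℂ) ≠ 0 := by exact_mod_cast hb.ne'
    refine differentiableAt_integrandNM hq0 ht0 hP hQ (fun i => by fun_prop) (fun j => by fun_prop)
      ?_ (by fun_prop) (fun i => mul_ne_zero hs0 (unitExp_ne_zero _))
      (fun j => mul_ne_zero hb0 (unitExp_ne_zero _)) fun i j => ?_
    · refine (differentiableAt_const
        (DeltaW (q : ℂ) t fun i => unitExp (w.1 i))).congr_of_eventuallyEq ?_
      filter_upwards [isOpen_ne.mem_nhds hs0] with z hz using DeltaW_smul _ _ hz _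
    · simpa [norm_unitExp, abs_of_pos hb] using h _ hs1 hs2
  · intro ρ h1 h2
    have hρ := hr.trans_le h1
    exact continuous_integrandNM hq0 hq1 ht0 ht1 hP hQ (fun i => by fun_prop)
      (fun j => by fun_prop) hρ hb (by simp [norm_unitExp, abs_of_pos hρ])
      (by simp [norm_unitExp, abs_of_pos hb]) (h ρ h1 h2)
  · intro ρ _ _ α
    simpa [torusPairing, unitExp, Measure.volume_eq_prod] using
      torusPairing_rotate (n := n) (m := m) (q := q) (t := t) (P := P) (Q := Q) ρ b α 0

lemma torusPairing_eq_right (hq0 : 0 < q) (hq1 : q < 1) (ht0 : 0 < t) (ht1 : t < 1)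
    (hP : InLambda n m q t P) (hQ : InLambda n m q t Q) {r R a : ℝ} (hr : 0 < r) (hrR : r ≤ R)
    (ha : 0 < a) (h : ∀ ρ, r ≤ ρ → ρ ≤ R → NonResonant (sqrtRatio q t) a ρ) :
    torusPairing n m q t P Q a R = torusPairing n m q t P Q a r := by
  have h_const := integral_eq_of_rotation_invariant
    (volume : Measure ((Fin n → Circ) × (Fin m → Circ))) (K := fun s w => integrandNM n m q t P Q
      (fun i => a * unitExp (w.1 i)) fun j => s * unitExp (w.2 j)) hr hrR
  refine h_const ?_ ?_ ?_
  · intro w s hs1 hs2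
    have hs0 : s ≠ 0 := norm_pos_iff.1 (hr.trans_le hs1)
    have ha0 : (a : ℂ) ≠ 0 := by exact_mod_cast ha.ne'
    refine differentiableAt_integrandNM hq0 ht0 hP hQ (fun i => by fun_prop) (fun j => by fun_prop)
      (by fun_prop) ?_ (fun i => mul_ne_zero ha0 (unitExp_ne_zero _))
      (fun j => mul_ne_zero hs0 (unitExp_ne_zero _)) fun i j => ?_
    · refine (differentiableAt_const
        (DeltaW (t : ℂ) q fun j => unitExp (w.2 j))).congr_of_eventuallyEq ?_
      filter_upwards [isOpen_ne.mem_nhds hs0] with z hz using DeltaW_smul _ _ hz _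
    · simpa [norm_unitExp, abs_of_pos ha] using h _ hs1 hs2
  · intro ρ h1 h2
    have hρ := hr.trans_le h1
    exact continuous_integrandNM hq0 hq1 ht0 ht1 hP hQ (fun i => by fun_prop)
      (fun j => by fun_prop) ha hρ (by simp [norm_unitExp, abs_of_pos ha])
      (by simp [norm_unitExp, abs_of_pos hρ]) (h ρ h1 h2)
  · intro ρ _ _ α
    simpa [torusPairing, unitExp, Measure.volume_eq_prod] using
      torusPairing_rotate (n := n) (m := m) (q := q) (t := t) (P := P) (Q := Q) a ρ 0 α

lemma pairingNM_eq_torusPairing (hq0 : 0 < q) (hq1 : q < 1) (ht0 : 0 < t) (ht1 : t < 1)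
    (hP : InLambda n m q t P) (hQ : InLambda n m q t Q) {a b : ℝ} (ha : 0 < a) (hb : 0 < b)
    (hab : NonResonant (sqrtRatio q t) a b) :
    pairingNM n m q t P Q a b =
      (1 / ((n.factorial : ℂ) * (m.factorial : ℂ))) * (1 / (2 * (Real.pi : ℂ)) ^ (n + m)) *
        torusPairing n m q t P Q a b := by
  have hcont : Continuous fun w : (Fin n → Circ) × (Fin m → Circ) => integrandNM n m q t P Q
      (fun i => a * unitExp (w.1 i)) fun j => b * unitExp (w.2 j) :=
    continuous_integrandNM hq0 hq1 ht0 ht1 hP hQ (fun i => by fun_prop) (fun j => by fun_prop)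
      ha hb (by simp [norm_unitExp, abs_of_pos ha]) (by simp [norm_unitExp, abs_of_pos hb]) hab
  have hcont' : ∀ u : Fin n → Circ, Continuous fun v : Fin m → Circ => integrandNM n m q t P Q
      (fun i => a * unitExp (u i)) fun j => b * unitExp (v j) := fun u =>
    continuous_integrandNM hq0 hq1 ht0 ht1 hP hQ (fun i => by fun_prop) (fun j => by fun_prop)
      ha hb (by simp [norm_unitExp, abs_of_pos ha]) (by simp [norm_unitExp, abs_of_pos hb]) hab
  rw [pairingNM, torusPairing, Measure.volume_eq_prod,
    integral_prod _ (hcont.integrable_of_hasCompactSupport (.of_compactSpace _)),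
    ← setIntegral_box_eq]
  · congr 2 with θ
    have h_box := setIntegral_box_eq (hcont' fun i => (θ i : Circ))
    simp only [integrandNM, unitExp_coe] at h_box ⊢
    exact h_box
  · simpa only [Measure.restrict_univ] using
      continuous_parametric_integral_of_continuous (μ := volume) hcont isCompact_univ

lemma nonResonant_of_Mmax_lt (hq0 : 0 < q) (ht0 : 0 < t) {a b : ℝ} (hb : 0 < b)
    (h : Mmax q t < a / b) : NonResonant (sqrtRatio q t) a b := by
  have hsq := Real.sqrt_pos.2 hq0
  have hst := Real.sqrt_pos.2 ht0
  rw [Mmax, max_lt_iff, lt_div_iff₀ hb, lt_div_iff₀ hb, div_mul_eq_mul_div, div_mul_eq_mul_div,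
    div_lt_iff₀ hst, div_lt_iff₀ hsq] at h
  simp only [NonResonant, sqrtRatio, ne_eq, mul_assoc, inv_mul_eq_iff_eq_mul₀ hsq.ne']
  constructor <;> intro h' <;> linarith [h.1, h.2]

lemma nonResonant_of_lt_inv_Mmax (hq0 : 0 < q) (ht0 : 0 < t) {a b : ℝ} (ha : 0 < a) (hb : 0 < b)
    (h : a / b < (Mmax q t)⁻¹) : NonResonant (sqrtRatio q t) a b := by
  have hM : 0 < Mmax q t := lt_max_of_lt_left (by positivity)
  have h' : Mmax q t < b / a := by rwa [← inv_div, lt_inv_comm₀ hM (by positivity)]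
  exact (nonResonant_of_Mmax_lt hq0 ht0 ha h').symm

/-- The pairing takes the same value at opposite corners of a rectangle of admissible radii. -/
lemma pairingNM_eq_of_rectangle (hq0 : 0 < q) (hq1 : q < 1) (ht0 : 0 < t) (ht1 : t < 1)
    (hP : InLambda n m q t P) (hQ : InLambda n m q t Q) {a A b B : ℝ} (ha : 0 < a) (haA : a ≤ A)
    (hb : 0 < b) (hbB : b ≤ B)
    (h : ∀ ρ σ, a ≤ ρ → ρ ≤ A → b ≤ σ → σ ≤ B → NonResonant (sqrtRatio q t) ρ σ) :
    pairingNM n m q t P Q A b = pairingNM n m q t P Q a B := by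
  rw [pairingNM_eq_torusPairing hq0 hq1 ht0 ht1 hP hQ (ha.trans_le haA) hb
      (h A b haA le_rfl le_rfl hbB),
    pairingNM_eq_torusPairing hq0 hq1 ht0 ht1 hP hQ ha (hb.trans_le hbB)
      (h a B le_rfl haA hbB le_rfl),
    torusPairing_eq_left hq0 hq1 ht0 ht1 hP hQ ha haA hb fun ρ h1 h2 => h ρ b h1 h2 le_rfl hbB,
    torusPairing_eq_right hq0 hq1 ht0 ht1 hP hQ hb hbB ha fun σ h1 h2 => h a σ le_rfl haA h1 h2]

end Integrand

theorem statement2 (n m : ℕ) (hn : 1 ≤ n) (hm : 1 ≤ m) (q t : ℝ)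
    (hq0 : 0 < q) (hq1 : q < 1) (ht0 : 0 < t) (ht1 : t < 1)
    (P Q : (Fin n → ℂ) → (Fin m → ℂ) → ℂ)
    (hP : InLambda n m q t P) (hQ : InLambda n m q t Q) :
    (∀ ξ₁ ξ₁' ξ₂ ξ₂' : ℝ, 0 < ξ₁ → 0 < ξ₁' → 0 < ξ₂ → 0 < ξ₂' →
        ξ₁ / ξ₁' > Mmax q t → ξ₂ / ξ₂' > Mmax q t →
        pairingNM n m q t P Q ξ₁ ξ₁' = pairingNM n m q t P Q ξ₂ ξ₂') ∧
      ∀ ξ₁ ξ₁' ξ₂ ξ₂' : ℝ, 0 < ξ₁ → 0 < ξ₁' → 0 < ξ₂ → 0 < ξ₂' →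
        ξ₁ / ξ₁' < (Mmax q t)⁻¹ → ξ₂ / ξ₂' < (Mmax q t)⁻¹ →
        pairingNM n m q t P Q ξ₁ ξ₁' = pairingNM n m q t P Q ξ₂ ξ₂' := by
  refine ⟨fun a b a' b' ha hb ha' hb' h h' => ?_, fun a b a' b' ha hb ha' hb' h h' => ?_⟩
  · have corner : ∀ {a b A B : ℝ}, 0 < a → 0 < B → a ≤ A → B ≤ b → Mmax q t < a / b →
        pairingNM n m q t P Q A B = pairingNM n m q t P Q a b := fun ha hB haA hBb h =>
      pairingNM_eq_of_rectangle hq0 hq1 ht0 ht1 hP hQ ha haA hB hBb fun ρ σ h1 _ h3 h4 =>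
        nonResonant_of_Mmax_lt hq0 ht0 (hB.trans_le h3)
          (h.trans_le (div_le_div₀ (ha.le.trans h1) h1 (hB.trans_le h3) h4))
    exact (corner ha (lt_min hb hb') (le_max_left a a') (min_le_left b b') h).symm.trans
      (corner ha' (lt_min hb hb') (le_max_right a a') (min_le_right b b') h')
  · have corner : ∀ {a b A B : ℝ}, 0 < A → 0 < b → A ≤ a → b ≤ B → a / b < (Mmax q t)⁻¹ →
        pairingNM n m q t P Q a b = pairingNM n m q t P Q A B := fun hA hb hAa hbB h =>
      pairingNM_eq_of_rectangle hq0 hq1 ht0 ht1 hP hQ hA hAa hb hbB fun ρ σ h1 h2 h3 _ =>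
        nonResonant_of_lt_inv_Mmax hq0 ht0 (hA.trans_le h1) (hb.trans_le h3)
          ((div_le_div₀ ((hA.trans_le h1).le.trans h2) h2 hb h3).trans_lt h)
    exact (corner (lt_min ha ha') hb (min_le_left a a') (le_max_left b b') h).trans
      (corner (lt_min ha ha') hb' (min_le_right a a') (le_max_right b b') h').symm
end
end

section
/- Let n,m ≥ 0 be integers, 0 < q < 1, 0 < t < 1, and let x ∈ ℂ^n, y ∈ ℂ^m be such that x_i ≠ x_{i′} for all i ≠ i′, y_j ≠ y_{j′} for all j ≠ j′, and t^{1/2} x_i ≠ q^{−1/2} y_j for all i,j. Then (t^{1−n}/(1−q)) Σ_{i=1}^n A_i(x,y;q,t) + (q^{m−1}/(1−t^{−1})) Σ_{j=1}^m B_j(x,y;q,t) = (1 − t^{−n} q^m)/((1−t^{−1})(1−q)). -/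
open Complex MeasureTheory Finset

noncomputable section

/-- The coefficient `A_i(x,y;q,t)`. -/
def Acoef (n m : ℕ) (q t : ℝ) (i : Fin n) (x : Fin n → ℂ) (y : Fin m → ℂ) : ℂ :=
  (∏ i' : Fin n, if i' ≠ i then ((t : ℂ) * x i - x i') / (x i - x i') else 1) *
    ∏ j : Fin m,
      ((Real.sqrt t : ℂ) * x i - (Real.sqrt q : ℂ) * y j) /
        ((Real.sqrt t : ℂ) * x i - (Real.sqrt q : ℂ)⁻¹ * y j)

/-- The coefficient `B_j(x,y;q,t)`. -/
def Bcoef (n m : ℕ) (q t : ℝ) (j : Fin m) (x : Fin n → ℂ) (y : Fin m → ℂ) : ℂ :=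
  (∏ j' : Fin m, if j' ≠ j then ((q : ℂ)⁻¹ * y j - y j') / (y j - y j') else 1) *
    ∏ i : Fin n,
      ((Real.sqrt q : ℂ)⁻¹ * y j - (Real.sqrt t : ℂ)⁻¹ * x i) /
        ((Real.sqrt q : ℂ)⁻¹ * y j - (Real.sqrt t : ℂ) * x i)


open Polynomial in
/-- For distinct nodes `w`, the residues of `∏ (a z - b w) / (z - w) · dz / z` sum to zero; the
identity also holds when one of the nodes is `0`. -/
theorem sum_sub_mul_prod_erase_div {F ι : Type*} [Field F] [DecidableEq ι] (s : Finset ι)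
    (a b w : ι → F) (hw : Set.InjOn w s) :
    ∑ k ∈ s, (a k - b k) * ∏ l ∈ s.erase k, (a l * w k - b l * w l) / (w k - w l) =
      ∏ k ∈ s, a k - ∏ k ∈ s, b k := by
  rcases s.eq_empty_or_nonempty with rfl | hs
  · simp
  let Q (u : Finset ι) : F[X] := ∏ l ∈ u, (C (a l) * X - C (b l * w l))
  let D (u : Finset ι) : F[X] := ∏ l ∈ u, (X - C (w l))
  let G (u : Finset ι) : F[X] := Q u - C (∏ l ∈ u, b l) * D u
  have hG (u : Finset ι) : X * (G u).divX = G u := by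
    conv_rhs => rw [← X_mul_divX_add (G u)]
    have : (G u).coeff 0 = 0 := by
      simp only [G, Q, D, coeff_zero_eq_eval_zero, eval_sub, eval_mul, eval_prod, eval_C, eval_X,
        ← Finset.prod_mul_distrib]
      rw [sub_eq_zero]
      exact Finset.prod_congr rfl fun l _ => by ring
    simp [this]
  have hQdeg : ∀ l ∈ s, (C (a l) * X - C (b l * w l)).natDegree ≤ 1 := fun l _ => by
    compute_degree
  have hDdeg : ∀ l ∈ s, (X - C (w l)).natDegree ≤ 1 := fun l _ => by compute_degree
  have hcard : 1 ≤ #s := hs.card_pos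
  have hcoeff : (G s).divX.coeff (#s - 1) = ∏ k ∈ s, a k - ∏ k ∈ s, b k := by
    have hQ := coeff_prod_of_natDegree_le (s := s) _ 1 hQdeg
    have hD := coeff_prod_of_natDegree_le (s := s) _ 1 hDdeg
    rw [mul_one] at hQ hD
    rw [coeff_divX, Nat.sub_add_cancel hcard, coeff_sub, coeff_C_mul, hQ, hD]
    simp [coeff_C]
  have hdeg : (G s).divX.degree < #s := by
    have hQ : (Q s).natDegree ≤ #s :=
      (natDegree_prod_le _ _).trans ((Finset.sum_le_card_nsmul _ _ 1 hQdeg).trans (by simp))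
    have hD : (D s).natDegree ≤ #s :=
      (natDegree_prod_le _ _).trans ((Finset.sum_le_card_nsmul _ _ 1 hDdeg).trans (by simp))
    have hGs : (G s).natDegree ≤ #s :=
      (natDegree_sub_le_of_le hQ ((natDegree_C_mul_le _ _).trans hD)).trans (max_self _).le
    refine degree_le_natDegree.trans_lt ?_
    rw [natDegree_divX_eq_natDegree_tsub_one]
    exact_mod_cast (by omega : (G s).natDegree - 1 < #s)
  rw [← hcoeff, Lagrange.coeff_eq_sum hw hdeg]
  refine Finset.sum_congr rfl fun k hk => ?_
  rw [Finset.prod_div_distrib, ← mul_div_assoc]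
  congr 1
  set u := s.erase k with hu
  have hsplit : (G s).divX =
      C (a k) * Q u - C (b k) * (C (∏ l ∈ u, b l) * D u) - C (b k * w k) * (G u).divX := by
    apply mul_left_cancel₀ (X_ne_zero (R := F))
    have hQs : Q s = (C (a k) * X - C (b k * w k)) * Q u := (Finset.mul_prod_erase s _ hk).symm
    have hDs : D s = (X - C (w k)) * D u := (Finset.mul_prod_erase s _ hk).symm
    have hbs : ∏ l ∈ s, b l = b k * ∏ l ∈ u, b l := (Finset.mul_prod_erase s _ hk).symm
    rw [hG, mul_sub, mul_left_comm X (C _) (G u).divX, hG]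
    simp only [G, hQs, hDs, hbs, C_mul]
    ring
  have hGk : w k * (G u).divX.eval (w k) = (G u).eval (w k) := by
    conv_rhs => rw [← hG u, eval_mul, eval_X]
  have hQk : (Q u).eval (w k) = ∏ l ∈ u, (a l * w k - b l * w l) := by simp [Q, eval_prod]
  rw [hsplit]
  simp only [eval_sub, eval_mul, eval_C]
  rw [mul_assoc, hGk]
  simp only [G, eval_sub, eval_mul, eval_C, hQk]
  ring

theorem prod_ite_ne_eq_prod_erase {ι M : Type*} [Fintype ι] [DecidableEq ι] [CommMonoid M]
    (k : ι) (f : ι → M) :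
    (∏ l, if l ≠ k then f l else 1) = ∏ l ∈ univ.erase k, f l := by
  rw [← Finset.prod_filter, Finset.filter_ne']

/-- The residue identity for two families of nodes `u` and `v` with weights `t` and `q`. -/
theorem sum_prod_add_sum_prod_eq {F : Type*} [Field F] {n m : ℕ} (q t : F)
    (u : Fin n → F) (v : Fin m → F) (hu : Function.Injective u) (hv : Function.Injective v)
    (huv : ∀ i j, u i ≠ v j) :
    (t - 1) * ∑ i, ((∏ i' ∈ univ.erase i, (t * u i - u i') / (u i - u i')) *
        ∏ j, (u i - q * v j) / (u i - v j)) +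
      (1 - q) * ∑ j, ((∏ j' ∈ univ.erase j, (v j - q * v j') / (v j - v j')) *
        ∏ i, (t * v j - u i) / (v j - u i)) = t ^ n - q ^ m := by
  have h := sum_sub_mul_prod_erase_div (univ : Finset (Fin n ⊕ Fin m))
    (Sum.elim (fun _ => t) fun _ => 1) (Sum.elim (fun _ => 1) fun _ => q) (Sum.elim u v)
    (hu.sumElim hv huv).injOn
  simp only [← prod_ite_ne_eq_prod_erase, Fintype.sum_sum_type, Fintype.prod_sum_type] at h ⊢
  simpa [Finset.mul_sum, mul_comm, mul_left_comm, mul_assoc] using h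

theorem Acoef_eq {n m : ℕ} {q t : ℝ} (hq : 0 < q) (ht : 0 < t) (i : Fin n) (x : Fin n → ℂ)
    (y : Fin m → ℂ) :
    Acoef n m q t i x y =
      (∏ i' ∈ univ.erase i, ((t : ℂ) * (Real.sqrt t * x i) - Real.sqrt t * x i') /
          (Real.sqrt t * x i - Real.sqrt t * x i')) *
        ∏ j, (Real.sqrt t * x i - (q : ℂ) * ((Real.sqrt q : ℂ)⁻¹ * y j)) /
          (Real.sqrt t * x i - (Real.sqrt q : ℂ)⁻¹ * y j) := by
  have ht' : (Real.sqrt t : ℂ) ≠ 0 := by exact_mod_cast (Real.sqrt_pos.2 ht).ne'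
  have hq' : (Real.sqrt q : ℂ) ≠ 0 := by exact_mod_cast (Real.sqrt_pos.2 hq).ne'
  have hqq : (q : ℂ) = Real.sqrt q * Real.sqrt q := by exact_mod_cast (Real.mul_self_sqrt hq.le).symm
  rw [Acoef, prod_ite_ne_eq_prod_erase]
  congr 1 <;> refine Finset.prod_congr rfl fun l _ => ?_
  · rw [mul_left_comm, ← mul_sub, ← mul_sub, mul_div_mul_left _ _ ht']
  · congr 2
    rw [hqq]
    field_simp

theorem Bcoef_eq {n m : ℕ} {q t : ℝ} (hq : 0 < q) (ht : 0 < t) (j : Fin m) (x : Fin n → ℂ)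
    (y : Fin m → ℂ) :
    (q : ℂ) ^ (m - 1) * (t : ℂ) ^ n * Bcoef n m q t j x y =
      (∏ j' ∈ univ.erase j, ((Real.sqrt q : ℂ)⁻¹ * y j - (q : ℂ) * ((Real.sqrt q : ℂ)⁻¹ * y j')) /
          ((Real.sqrt q : ℂ)⁻¹ * y j - (Real.sqrt q : ℂ)⁻¹ * y j')) *
        ∏ i, ((t : ℂ) * ((Real.sqrt q : ℂ)⁻¹ * y j) - Real.sqrt t * x i) /
          ((Real.sqrt q : ℂ)⁻¹ * y j - Real.sqrt t * x i) := by
  have ht' : (Real.sqrt t : ℂ) ≠ 0 := by exact_mod_cast (Real.sqrt_pos.2 ht).ne'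
  have hq' : (Real.sqrt q : ℂ)⁻¹ ≠ 0 :=
    inv_ne_zero (by exact_mod_cast (Real.sqrt_pos.2 hq).ne')
  have htt : (t : ℂ) = Real.sqrt t * Real.sqrt t := by exact_mod_cast (Real.mul_self_sqrt ht.le).symm
  have hq0 : (q : ℂ) ≠ 0 := by exact_mod_cast hq.ne'
  have hcard : #((univ : Finset (Fin m)).erase j) = m - 1 := by simp
  have hpow (f : Fin n → ℂ) : (t : ℂ) ^ n * ∏ i, f i = ∏ i, t * f i := by
    simp [Finset.prod_mul_distrib]
  rw [Bcoef, prod_ite_ne_eq_prod_erase, mul_mul_mul_comm]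
  congr 1
  · rw [← hcard, Finset.pow_card_mul_prod]
    refine Finset.prod_congr rfl fun l _ => ?_
    rw [mul_left_comm (q : ℂ), ← mul_sub, ← mul_sub, mul_div_mul_left _ _ hq', ← mul_div_assoc,
      mul_sub, mul_inv_cancel_left₀ hq0]
  · rw [hpow]
    refine Finset.prod_congr rfl fun l _ => ?_
    rw [← mul_div_assoc, mul_sub]
    congr 2
    rw [htt]
    field_simp

theorem statement4 (n m : ℕ) (q t : ℝ)
    (hq0 : 0 < q) (hq1 : q < 1) (ht0 : 0 < t) (ht1 : t < 1)
    (x : Fin n → ℂ) (y : Fin m → ℂ)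
    (hx : ∀ i i' : Fin n, i ≠ i' → x i ≠ x i')
    (hy : ∀ j j' : Fin m, j ≠ j' → y j ≠ y j')
    (hxy : ∀ (i : Fin n) (j : Fin m),
      (Real.sqrt t : ℂ) * x i ≠ (Real.sqrt q : ℂ)⁻¹ * y j) :
    (t : ℂ) ^ ((1 : ℤ) - n) / (1 - (q : ℂ)) * ∑ i : Fin n, Acoef n m q t i x y +
        (q : ℂ) ^ ((m : ℤ) - 1) / (1 - (t : ℂ)⁻¹) * ∑ j : Fin m, Bcoef n m q t j x y =
      (1 - (t : ℂ) ^ (-(n : ℤ)) * (q : ℂ) ^ m) / ((1 - (t : ℂ)⁻¹) * (1 - (q : ℂ))) := by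
  have ht' : (Real.sqrt t : ℂ) ≠ 0 := by exact_mod_cast (Real.sqrt_pos.2 ht0).ne'
  have hq' : (Real.sqrt q : ℂ)⁻¹ ≠ 0 :=
    inv_ne_zero (by exact_mod_cast (Real.sqrt_pos.2 hq0).ne')
  have htz : (t : ℂ) ≠ 0 := by exact_mod_cast ht0.ne'
  have hqz : (q : ℂ) ≠ 0 := by exact_mod_cast hq0.ne'
  have ht1' : (t : ℂ) - 1 ≠ 0 := sub_ne_zero.2 (by exact_mod_cast ht1.ne)
  have hq1' : 1 - (q : ℂ) ≠ 0 := sub_ne_zero.2 (by exact_mod_cast hq1.ne')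
  have key := sum_prod_add_sum_prod_eq (q : ℂ) (t : ℂ) (fun i => (Real.sqrt t : ℂ) * x i)
    (fun j => (Real.sqrt q : ℂ)⁻¹ * y j)
    (fun i i' h => by_contra fun hne => hx i i' hne (mul_left_cancel₀ ht' h))
    (fun j j' h => by_contra fun hne => hy j j' hne (mul_left_cancel₀ hq' h)) hxy
  simp only [← Acoef_eq hq0 ht0, ← Bcoef_eq hq0 ht0, ← Finset.mul_sum] at key
  have hpow : (q : ℂ) ^ ((m : ℤ) - 1) * ∑ j, Bcoef n m q t j x y =
      (q : ℂ) ^ (m - 1) * ∑ j, Bcoef n m q t j x y := by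
    rcases m with _ | m
    · simp
    · simp
  have hinv : 1 - (t : ℂ)⁻¹ = (t - 1) / t := by field_simp
  rw [div_mul_eq_mul_div _ _ (∑ j, Bcoef n m q t j x y), hpow, hinv, zpow_sub₀ htz, zpow_neg,
    zpow_one, zpow_natCast]
  field_simp
  linear_combination key
end
end
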